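/- Let g ≥ 1, let τ be an element of the Siegel upper half-space H_g, let z ∈ ℂ^g, let ε ∈ ℤ^g, and let δ ∈ {0,1}^g ⊂ ℤ^g. Then Σ_{α ∈ {0,1}^g} (−1)^{α·δ} Θ[α](τ,z)·Θ[α+ε](τ,0) = (θ[ε,δ](τ,z))², where Θ[α](τ,z) := θ[α,0](2τ,2z) is the second order theta function with characteristic α, the sum ranges over the 2^g vectors α ∈ {0,1}^g ⊂ ℤ^g, and α+ε is a literal sum of integer vectors. -/

import Mathlib

open scoped BigOperators
open Complex

noncomputable section

/-- The Siegel upper half-space condition: a complex symmetric `g × g` matrix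
whose imaginary part is positive definite. -/
def IsSiegel {g : ℕ} (τ : Matrix (Fin g) (Fin g) ℂ) : Prop :=
  τ.IsSymm ∧ Matrix.PosDef (Matrix.of fun i j => (τ i j).im)

/-- The theta function with characteristic `[ε, δ]`:
`θ[ε,δ](τ,z) = Σ_{m ∈ ℤ^g} exp(πi((m+ε/2)ᵀτ(m+ε/2) + 2(m+ε/2)·(z+δ/2)))`. -/
def theta {g : ℕ} (τ : Matrix (Fin g) (Fin g) ℂ) (ε δ : Fin g → ℤ)
    (z : Fin g → ℂ) : ℂ :=
  ∑' m : Fin g → ℤ,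
    Complex.exp (↑Real.pi * Complex.I *
      ((∑ i, ∑ j, ((m i : ℂ) + (ε i : ℂ) / 2) * τ i j * ((m j : ℂ) + (ε j : ℂ) / 2)) +
        2 * ∑ i, ((m i : ℂ) + (ε i : ℂ) / 2) * (z i + (δ i : ℂ) / 2)))

/-- The second order theta function `Θ[ε](τ,z) := θ[ε,0](2τ,2z)`. -/
def theta2 {g : ℕ} (τ : Matrix (Fin g) (Fin g) ℂ) (ε : Fin g → ℤ)
    (z : Fin g → ℂ) : ℂ :=
  theta ((2 : ℂ) • τ) ε 0 (fun k => 2 * z k)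

/-- A positive definite real quadratic form dominates a positive multiple of the sum of squares. -/
lemma exists_pos_mul_sum_sq_le_of_posDef {ι : Type*} [Fintype ι] {Y : Matrix ι ι ℝ}
    (hY : Y.PosDef) :
    ∃ c : ℝ, 0 < c ∧ ∀ x : ι → ℝ, c * ∑ i, x i ^ 2 ≤ ∑ i, ∑ j, x i * Y i j * x j := by
  have hpos : ∀ x : ι → ℝ, x ≠ 0 → 0 < ∑ i, ∑ j, x i * Y i j * x j := fun x hx => by
    simpa [dotProduct, Matrix.mulVec, Finset.mul_sum, mul_assoc] using hY.dotProduct_mulVec_pos hx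
  obtain ⟨b, hb, hle⟩ := (isCompact_sphere (0 : ι → ℝ) 1).exists_forall_le'
    (f := fun x : ι → ℝ => ∑ i, ∑ j, x i * Y i j * x j) (a := 0)
    (by fun_prop) (fun x hx => hpos x (by rintro rfl; simp at hx))
  refine ⟨b / (Fintype.card ι + 1), by positivity, fun x => ?_⟩
  rcases eq_or_ne x 0 with rfl | hx
  · simp
  have hnorm : 0 < ‖x‖ := norm_pos_iff.2 hx
  have hsq : ∑ i, x i ^ 2 ≤ (Fintype.card ι + 1) * ‖x‖ ^ 2 := by
    calc ∑ i, x i ^ 2 ≤ ∑ _i : ι, ‖x‖ ^ 2 := by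
          refine Finset.sum_le_sum fun i _ => ?_
          rw [← sq_abs, ← Real.norm_eq_abs]
          exact pow_le_pow_left₀ (norm_nonneg _) (norm_le_pi_norm x i) 2
      _ ≤ (Fintype.card ι + 1) * ‖x‖ ^ 2 := by
          rw [Finset.sum_const, Finset.card_univ, nsmul_eq_mul]
          gcongr
          linarith
  have hscale : ∑ i, ∑ j, (‖x‖⁻¹ • x) i * Y i j * (‖x‖⁻¹ • x) j =
      (‖x‖ ^ 2)⁻¹ * ∑ i, ∑ j, x i * Y i j * x j := by
    simp only [Finset.mul_sum, Pi.smul_apply, smul_eq_mul]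
    refine Finset.sum_congr rfl fun i _ => Finset.sum_congr rfl fun j _ => ?_
    rw [← inv_pow]
    ring
  have hunit := hle (‖x‖⁻¹ • x) (by simp [norm_smul, hnorm.ne'])
  rw [hscale, inv_mul_eq_div, le_div_iff₀ (by positivity)] at hunit
  calc b / (Fintype.card ι + 1) * ∑ i, x i ^ 2
      ≤ b / (Fintype.card ι + 1) * ((Fintype.card ι + 1) * ‖x‖ ^ 2) := by gcongr
    _ = b * ‖x‖ ^ 2 := by field_simp
    _ ≤ _ := hunit

/-- A finite product of nonnegative summable families is summable on the product index type. -/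
lemma summable_prod_apply_of_nonneg {β : Type*} {g : ℕ} {F : Fin g → β → ℝ}
    (hnonneg : ∀ i b, 0 ≤ F i b) (hsum : ∀ i, Summable (F i)) :
    Summable fun m : Fin g → β => ∏ i, F i (m i) := by
  induction g with
  | zero => exact Summable.of_finite
  | succ g ih =>
    rw [← (Fin.consEquiv fun _ : Fin (g + 1) => β).summable_iff]
    have htail := ih (fun i b => hnonneg i.succ b) fun i => hsum i.succ
    refine ((hsum 0).mul_of_nonneg htail (hnonneg 0)
      fun m => Finset.prod_nonneg fun i _ => hnonneg i.succ (m i)).congr fun x => ?_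
    simp [Fin.prod_univ_succ, Fin.consEquiv]

/-- Gaussian sums over a shifted copy of the integers converge. -/
lemma summable_exp_neg_quadratic_shift {c : ℝ} (hc : 0 < c) (s v : ℝ) :
    Summable fun n : ℤ => Real.exp (-Real.pi * (c * (n + s) ^ 2 + 2 * ((n + s) * v))) := by
  have h := ((summable_jacobiTheta₂_term_iff (((c * s + v : ℝ) : ℂ) * I) ((c : ℂ) * I)).2
    (by simpa using hc)).norm.mul_left (Real.exp (-Real.pi * (c * s ^ 2 + 2 * (s * v))))
  refine h.congr fun n => ?_
  rw [norm_jacobiTheta₂_term, ← Real.exp_add]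
  congr 1
  simp
  ring

/-- The general term of the series defining `theta`. -/
def thetaTerm {g : ℕ} (τ : Matrix (Fin g) (Fin g) ℂ) (ε δ : Fin g → ℤ)
    (z : Fin g → ℂ) (m : Fin g → ℤ) : ℂ :=
  Complex.exp (↑Real.pi * Complex.I *
    ((∑ i, ∑ j, ((m i : ℂ) + (ε i : ℂ) / 2) * τ i j * ((m j : ℂ) + (ε j : ℂ) / 2)) +
      2 * ∑ i, ((m i : ℂ) + (ε i : ℂ) / 2) * (z i + (δ i : ℂ) / 2)))

lemma norm_thetaTerm {g : ℕ} (τ : Matrix (Fin g) (Fin g) ℂ) (ε δ : Fin g → ℤ)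
    (z : Fin g → ℂ) (m : Fin g → ℤ) :
    ‖thetaTerm τ ε δ z m‖ = Real.exp (-Real.pi *
      ((∑ i, ∑ j, ((m i : ℝ) + ε i / 2) * (τ i j).im * ((m j : ℝ) + ε j / 2)) +
        2 * ∑ i, ((m i : ℝ) + ε i / 2) * (z i).im)) := by
  have hcast : ∀ i, (m i : ℂ) + (ε i : ℂ) / 2 = (((m i : ℝ) + ε i / 2 : ℝ) : ℂ) := by
    intro i; push_cast; rfl
  have hδ : ∀ i, (z i + (δ i : ℂ) / 2).im = (z i).im := by
    intro i
    have : (δ i : ℂ) / 2 = ((δ i / 2 : ℝ) : ℂ) := by push_cast; rfl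
    rw [this, add_im, ofReal_im, add_zero]
  have hre : ∀ w : ℂ, (↑Real.pi * Complex.I * w).re = -Real.pi * w.im := by
    intro w; simp
  have htwo : ∀ w : ℂ, (2 * w).im = 2 * w.im := by intro w; simp
  rw [thetaTerm, Complex.norm_exp, hre]
  simp only [hcast, add_im, htwo, im_sum, im_ofReal_mul, im_mul_ofReal, hδ]

lemma summable_norm_thetaTerm {g : ℕ} {τ : Matrix (Fin g) (Fin g) ℂ} (hτ : IsSiegel τ)
    (ε δ : Fin g → ℤ) (z : Fin g → ℂ) : Summable fun m => ‖thetaTerm τ ε δ z m‖ := by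
  obtain ⟨c, hc, hle⟩ := exists_pos_mul_sum_sq_le_of_posDef hτ.2
  refine (summable_prod_apply_of_nonneg (fun _ _ => (Real.exp_pos _).le) fun i =>
    summable_exp_neg_quadratic_shift hc (ε i / 2) (z i).im).of_nonneg_of_le
      (fun _ => norm_nonneg _) fun m => ?_
  rw [norm_thetaTerm, ← Real.exp_sum, Real.exp_le_exp, ← Finset.mul_sum,
    Finset.sum_add_distrib, ← Finset.mul_sum, ← Finset.mul_sum]
  refine mul_le_mul_of_nonpos_left ?_ (neg_nonpos.2 Real.pi_pos.le)
  gcongr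
  exact hle fun i => (m i : ℝ) + ε i / 2

lemma IsSiegel.two_smul {g : ℕ} {τ : Matrix (Fin g) (Fin g) ℂ} (hτ : IsSiegel τ) :
    IsSiegel ((2 : ℂ) • τ) := by
  refine ⟨hτ.1.smul 2, ?_⟩
  convert hτ.2.smul (two_pos : (0 : ℝ) < 2) using 1
  ext i j
  simp

/-- The change of summation indices `m = p + q + α`, `n = p - q - ε`, where `p` and `α` are
the quotient and remainder of `m + n + ε` on division by two. -/
def sumDiffEquiv {g : ℕ} (ε : Fin g → ℤ) :
    (Fin g → Fin 2) × ((Fin g → ℤ) × (Fin g → ℤ)) ≃ (Fin g → ℤ) × (Fin g → ℤ) where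
  toFun x := (fun k => x.2.1 k + x.2.2 k + ((x.1 k : ℕ) : ℤ), fun k => x.2.1 k - x.2.2 k - ε k)
  invFun y :=
    (fun k => ⟨((y.1 k + y.2 k + ε k) % 2).toNat, by omega⟩,
      (fun k => (y.1 k + y.2 k + ε k) / 2,
        fun k => (y.1 k + y.2 k + ε k) / 2 - y.2 k - ε k))
  left_inv x := by
    obtain ⟨α, p, q⟩ := x
    ext k
    · have := (α k).isLt
      simp only
      omega
    · have := (α k).isLt
      simp only
      omega
    · have := (α k).isLt
      simp only
      omega
  right_inv y := by
    obtain ⟨m, n⟩ := y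
    ext k
    · simp only
      omega
    · simp only
      omega

lemma thetaTerm_mul_thetaTerm_sumDiffEquiv {g : ℕ} (τ : Matrix (Fin g) (Fin g) ℂ)
    (ε δ : Fin g → ℤ) (z : Fin g → ℂ) (α : Fin g → Fin 2) (x : (Fin g → ℤ) × (Fin g → ℤ)) :
    thetaTerm τ ε δ z (sumDiffEquiv ε (α, x)).1 * thetaTerm τ ε δ z (sumDiffEquiv ε (α, x)).2 =
      (-1 : ℂ) ^ (∑ k, ((α k : ℕ) : ℤ) * δ k) *
        (thetaTerm ((2 : ℂ) • τ) (fun k => ((α k : ℕ) : ℤ)) 0 (fun k => 2 * z k) x.1 *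
          thetaTerm ((2 : ℂ) • τ) ((fun k => ((α k : ℕ) : ℤ)) + ε) 0
            (fun k => 2 * (0 : Fin g → ℂ) k) x.2) := by
  obtain ⟨p, q⟩ := x
  simp only [thetaTerm, sumDiffEquiv, Equiv.coe_fn_mk]
  rw [← Complex.exp_pi_mul_I, ← Complex.exp_int_mul, ← Complex.exp_add, ← Complex.exp_add,
    ← Complex.exp_add, Complex.exp_eq_exp_iff_exists_int]
  refine ⟨∑ k, p k * δ k, ?_⟩
  have hquad : (∑ i, ∑ j, (((p i + q i + ((α i : ℕ) : ℤ) : ℤ) : ℂ) + (ε i : ℂ) / 2) * τ i j *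
        (((p j + q j + ((α j : ℕ) : ℤ) : ℤ) : ℂ) + (ε j : ℂ) / 2)) +
      (∑ i, ∑ j, (((p i - q i - ε i : ℤ) : ℂ) + (ε i : ℂ) / 2) * τ i j *
        (((p j - q j - ε j : ℤ) : ℂ) + (ε j : ℂ) / 2)) =
      (∑ i, ∑ j, ((p i : ℂ) + (((α i : ℕ) : ℤ) : ℂ) / 2) * ((2 : ℂ) • τ) i j *
        ((p j : ℂ) + (((α j : ℕ) : ℤ) : ℂ) / 2)) +
      (∑ i, ∑ j, ((q i : ℂ) + ((((fun k => ((α k : ℕ) : ℤ)) + ε) i : ℤ) : ℂ) / 2) *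
        ((2 : ℂ) • τ) i j *
        ((q j : ℂ) + ((((fun k => ((α k : ℕ) : ℤ)) + ε) j : ℤ) : ℂ) / 2)) := by
    simp only [← Finset.sum_add_distrib]
    refine Finset.sum_congr rfl fun i _ => Finset.sum_congr rfl fun j _ => ?_
    simp only [Matrix.smul_apply, smul_eq_mul, Pi.add_apply]
    push_cast
    ring
  have hlin : 2 * (∑ i, (((p i + q i + ((α i : ℕ) : ℤ) : ℤ) : ℂ) + (ε i : ℂ) / 2) *
        (z i + (δ i : ℂ) / 2)) +
      2 * (∑ i, (((p i - q i - ε i : ℤ) : ℂ) + (ε i : ℂ) / 2) * (z i + (δ i : ℂ) / 2)) =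
      ((∑ k, ((α k : ℕ) : ℤ) * δ k : ℤ) : ℂ) +
      2 * (∑ i, ((p i : ℂ) + (((α i : ℕ) : ℤ) : ℂ) / 2) *
        (2 * z i + (((0 : Fin g → ℤ) i : ℤ) : ℂ) / 2)) +
      2 * (∑ i, ((q i : ℂ) + ((((fun k => ((α k : ℕ) : ℤ)) + ε) i : ℤ) : ℂ) / 2) *
        (2 * (0 : Fin g → ℂ) i + (((0 : Fin g → ℤ) i : ℤ) : ℂ) / 2)) +
      2 * ((∑ k, p k * δ k : ℤ) : ℂ) := by
    push_cast
    simp only [Finset.mul_sum, ← Finset.sum_add_distrib]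
    refine Finset.sum_congr rfl fun i _ => ?_
    simp only [Pi.zero_apply, Int.cast_zero]
    ring
  linear_combination (↑Real.pi * Complex.I) * (hquad + hlin)

theorem statement7 {g : ℕ} (hg : 1 ≤ g) (τ : Matrix (Fin g) (Fin g) ℂ)
    (hτ : IsSiegel τ) (z : Fin g → ℂ) (ε : Fin g → ℤ) (δ : Fin g → ℤ)
    (hδ : ∀ k, δ k = 0 ∨ δ k = 1) :
    ∑ α : Fin g → Fin 2,
        (-1 : ℂ) ^ (∑ k, ((α k : ℕ) : ℤ) * δ k) *
          (theta2 τ (fun k => ((α k : ℕ) : ℤ)) z *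
            theta2 τ ((fun k => ((α k : ℕ) : ℤ)) + ε) 0) =
      (theta τ ε δ z) ^ 2 := by
  have hs := summable_norm_thetaTerm hτ ε δ z
  have hsum := (sumDiffEquiv ε).summable_iff.2 (summable_mul_of_summable_norm hs hs)
  rw [Function.comp_def] at hsum
  have htheta : theta τ ε δ z ^ 2 =
      ∑' x : (Fin g → ℤ) × (Fin g → ℤ), thetaTerm τ ε δ z x.1 * thetaTerm τ ε δ z x.2 :=
    (sq _).trans (tsum_mul_tsum_of_summable_norm hs hs)
  rw [htheta, ← (sumDiffEquiv ε).tsum_eq, hsum.tsum_prod, tsum_fintype]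
  refine Finset.sum_congr rfl fun α _ => ?_
  simp only [thetaTerm_mul_thetaTerm_sumDiffEquiv]
  rw [tsum_mul_left, ← tsum_mul_tsum_of_summable_norm
    (summable_norm_thetaTerm hτ.two_smul _ _ _) (summable_norm_thetaTerm hτ.two_smul _ _ _)]
  rfl
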